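/- arXiv:1308.0955 — 3 statements merged into one kernel-verified Lean document; each statement's English description precedes it below -/
import Mathlib

section
/- With α, β, γ the polynomials in λ₁, λ₂, μ₁, μ₂ defined by α = −λ₁³μ₁²μ₂ − λ₁²λ₂μ₂³ − λ₁λ₂²μ₁³ + λ₂³μ₁μ₂², β = −λ₁⁴μ₁μ₂³ + λ₁³λ₂μ₁⁴ + 3λ₁²λ₂²μ₁²μ₂² − λ₁λ₂³μ₂⁴ + λ₂⁴μ₁³μ₂, γ = −λ₁⁵(μ₁⁵ + μ₂⁵) + 10λ₁⁴λ₂μ₁³μ₂² − 10λ₁³λ₂²μ₁μ₂⁴ − 10λ₁²λ₂³μ₁⁴μ₂ − 10λ₁λ₂⁴μ₁²μ₂³ + λ₂⁵(μ₁⁵ − μ₂⁵), and with f(z₁,z₂) = z₁z₂(z₁¹⁰ + 11z₁⁵z₂⁵ − z₂¹⁰), the following identity holds in ℤ[λ₁,λ₂,μ₁,μ₂]: f(λ₁,λ₂)·f(μ₁,μ₂) = α⁴ − β³ + αβγ. -/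
open MvPolynomial

/-- The degree-12 icosahedral invariant form. -/
def icosF {R : Type*} [CommRing R] (a b : R) : R :=
  a * b * (a ^ 10 + 11 * a ^ 5 * b ^ 5 - b ^ 10)

/-- Coefficient form `α` of the parametrized canonical quintic
(variables `X 0 = λ₁`, `X 1 = λ₂`, `X 2 = μ₁`, `X 3 = μ₂`). -/
noncomputable def coeffA : MvPolynomial (Fin 4) ℤ :=
  -(X 0) ^ 3 * (X 2) ^ 2 * X 3 - (X 0) ^ 2 * X 1 * (X 3) ^ 3
    - X 0 * (X 1) ^ 2 * (X 2) ^ 3 + (X 1) ^ 3 * X 2 * (X 3) ^ 2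

/-- Coefficient form `β` of the parametrized canonical quintic. -/
noncomputable def coeffB : MvPolynomial (Fin 4) ℤ :=
  -(X 0) ^ 4 * X 2 * (X 3) ^ 3 + (X 0) ^ 3 * X 1 * (X 2) ^ 4
    + 3 * (X 0) ^ 2 * (X 1) ^ 2 * (X 2) ^ 2 * (X 3) ^ 2
    - X 0 * (X 1) ^ 3 * (X 3) ^ 4 + (X 1) ^ 4 * (X 2) ^ 3 * X 3

/-- Coefficient form `γ` of the parametrized canonical quintic. -/
noncomputable def coeffC : MvPolynomial (Fin 4) ℤ :=
  -(X 0) ^ 5 * ((X 2) ^ 5 + (X 3) ^ 5) + 10 * (X 0) ^ 4 * X 1 * (X 2) ^ 3 * (X 3) ^ 2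
    - 10 * (X 0) ^ 3 * (X 1) ^ 2 * X 2 * (X 3) ^ 4
    - 10 * (X 0) ^ 2 * (X 1) ^ 3 * (X 2) ^ 4 * X 3
    - 10 * X 0 * (X 1) ^ 4 * (X 2) ^ 2 * (X 3) ^ 3
    + (X 1) ^ 5 * ((X 2) ^ 5 - (X 3) ^ 5)

/-- `f₁f₂ = α⁴ − β³ + αβγ` in `ℤ[λ₁,λ₂,μ₁,μ₂]`. -/
theorem f1f2_eq :
    icosF (X 0 : MvPolynomial (Fin 4) ℤ) (X 1) * icosF (X 2) (X 3) =
      coeffA ^ 4 - coeffB ^ 3 + coeffA * coeffB * coeffC := by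
  unfold icosF coeffA coeffB coeffC
  generalize (X 0 : MvPolynomial (Fin 4) ℤ) = a
  generalize (X 1 : MvPolynomial (Fin 4) ℤ) = b
  generalize (X 2 : MvPolynomial (Fin 4) ℤ) = c
  generalize (X 3 : MvPolynomial (Fin 4) ℤ) = d
  ring
end

section
/- With α, β, γ the polynomials in λ₁, λ₂, μ₁, μ₂ defined by α = −λ₁³μ₁²μ₂ − λ₁²λ₂μ₂³ − λ₁λ₂²μ₁³ + λ₂³μ₁μ₂², β = −λ₁⁴μ₁μ₂³ + λ₁³λ₂μ₁⁴ + 3λ₁²λ₂²μ₁²μ₂² − λ₁λ₂³μ₂⁴ + λ₂⁴μ₁³μ₂, γ = −λ₁⁵(μ₁⁵ + μ₂⁵) + 10λ₁⁴λ₂μ₁³μ₂² − 10λ₁³λ₂²μ₁μ₂⁴ − 10λ₁²λ₂³μ₁⁴μ₂ − 10λ₁λ₂⁴μ₁²μ₂³ + λ₂⁵(μ₁⁵ − μ₂⁵), and with H(z₁,z₂) = −(z₁²⁰ + z₂²⁰) + 228(z₁¹⁵z₂⁵ − z₁⁵z₂¹⁵) − 494z₁¹⁰z₂¹⁰, the following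 identity holds in ℤ[λ₁,λ₂,μ₁,μ₂]: H(λ₁,λ₂)·H(μ₁,μ₂) = γ⁴ + 40α²βγ² − 192α⁵γ − 120αβ³γ + 640α⁴β² − 144β⁵. -/
open MvPolynomial

/-- The degree-20 icosahedral invariant form. -/
def icosH {R : Type*} [CommRing R] (a b : R) : R :=
  -(a ^ 20 + b ^ 20) + 228 * (a ^ 15 * b ^ 5 - a ^ 5 * b ^ 15) - 494 * a ^ 10 * b ^ 10

set_option maxRecDepth 100000 in
set_option maxHeartbeats 4000000 in
theorem H1H2_aux {R : Type*} [CommRing R] (x y u v A B C : R)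
    (hA : A = -x ^ 3 * u ^ 2 * v - x ^ 2 * y * v ^ 3 - x * y ^ 2 * u ^ 3 + y ^ 3 * u * v ^ 2)
    (hB : B = -x ^ 4 * u * v ^ 3 + x ^ 3 * y * u ^ 4 + 3 * x ^ 2 * y ^ 2 * u ^ 2 * v ^ 2
      - x * y ^ 3 * v ^ 4 + y ^ 4 * u ^ 3 * v)
    (hC : C = -x ^ 5 * (u ^ 5 + v ^ 5) + 10 * x ^ 4 * y * u ^ 3 * v ^ 2
      - 10 * x ^ 3 * y ^ 2 * u * v ^ 4 - 10 * x ^ 2 * y ^ 3 * u ^ 4 * v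
      - 10 * x * y ^ 4 * u ^ 2 * v ^ 3 + y ^ 5 * (u ^ 5 - v ^ 5)) :
    icosH x y * icosH u v = C ^ 4 + 40 * A ^ 2 * B * C ^ 2 - 192 * A ^ 5 * C
      - 120 * A * B ^ 3 * C + 640 * A ^ 4 * B ^ 2 - 144 * B ^ 5 := by
  subst hA hB hC
  unfold icosH
  ring

/-- `H₁H₂ = γ⁴ + 40α²βγ² − 192α⁵γ − 120αβ³γ + 640α⁴β² − 144β⁵` in `ℤ[λ₁,λ₂,μ₁,μ₂]`. -/
theorem H1H2_eq :
    icosH (X 0 : MvPolynomial (Fin 4) ℤ) (X 1) * icosH (X 2) (X 3) =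
      coeffC ^ 4 + 40 * coeffA ^ 2 * coeffB * coeffC ^ 2 - 192 * coeffA ^ 5 * coeffC - 120 * coeffA * coeffB ^ 3 * coeffC + 640 * coeffA ^ 4 * coeffB ^ 2 - 144 * coeffB ^ 5 :=
  H1H2_aux _ _ _ _ _ _ _ rfl rfl rfl
end

section
/- With α, β, γ the polynomials in λ₁, λ₂, μ₁, μ₂ defined by α = −λ₁³μ₁²μ₂ − λ₁²λ₂μ₂³ − λ₁λ₂²μ₁³ + λ₂³μ₁μ₂², β = −λ₁⁴μ₁μ₂³ + λ₁³λ₂μ₁⁴ + 3λ₁²λ₂²μ₁²μ₂² − λ₁λ₂³μ₂⁴ + λ₂⁴μ₁³μ₂, γ = −λ₁⁵(μ₁⁵ + μ₂⁵) + 10λ₁⁴λ₂μ₁³μ₂² − 10λ₁³λ₂²μ₁μ₂⁴ − 10λ₁²λ₂³μ₁⁴μ₂ − 10λ₁λ₂⁴μ₁²μ₂³ + λ₂⁵(μ₁⁵ − μ₂⁵), and with T(z₁,z₂) = (z₁³⁰ + z₂³⁰) + 522(z₁²⁵z₂⁵ − z₁⁵z₂²⁵) − 10005(z₁²⁰z₂¹⁰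 + z₁¹⁰z₂²⁰), the following identity holds in ℤ[λ₁,λ₂,μ₁,μ₂]: T(λ₁,λ₂)·T(μ₁,μ₂) = γ⁶ + 60α²βγ⁴ + 576α⁵γ³ − 180αβ³γ³ + 648β⁵γ² − 2760α⁴β²γ² + 7200α⁷βγ − 1728α¹⁰ + 9360α³β⁴γ − 2080α⁶β³ − 16200α²β⁶. -/
open MvPolynomial

/-- The degree-30 icosahedral invariant form. -/
def icosT {R : Type*} [CommRing R] (a b : R) : R :=
  (a ^ 30 + b ^ 30) + 522 * (a ^ 25 * b ^ 5 - a ^ 5 * b ^ 25) - 10005 * (a ^ 20 * b ^ 10 + a ^ 10 * b ^ 20)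

set_option maxHeartbeats 0
set_option maxRecDepth 100000

theorem T_aux {R : Type*} [CommRing R] (x y z w A B C : R)
    (hA : A = -x^3*z^2*w-x^2*y*w^3-x*y^2*z^3+y^3*z*w^2)
    (hB : B = -x^4*z*w^3+x^3*y*z^4+3*x^2*y^2*z^2*w^2-x*y^3*w^4+y^4*z^3*w)
    (hC : C = -x^5*(z^5+w^5)+10*x^4*y*z^3*w^2-10*x^3*y^2*z*w^4-10*x^2*y^3*z^4*w-10*x*y^4*z^2*w^3+y^5*(z^5-w^5)) :
    icosT x y * icosT z w = 
      C ^ 6 + 60 * A ^ 2 * B * C ^ 4 + 576 * A ^ 5 * C ^ 3 - 180 * A * B ^ 3 * C ^ 3 + 648 * B ^ 5 * C ^ 2 - 2760 * A ^ 4 * B ^ 2 * C ^ 2 + 7200 * A ^ 7 * B * C - 1728 * A ^ 10 + 9360 * A ^ 3 * B ^ 4 * C - 2080 * A ^ 6 * B ^ 3 - 16200 * A ^ 2 * B ^ 6 := by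
  subst hA hB hC
  unfold icosT
  ring

/-- `T₁T₂` expressed in the coefficient forms, in `ℤ[λ₁,λ₂,μ₁,μ₂]`. -/
theorem T1T2_eq :
    icosT (X 0 : MvPolynomial (Fin 4) ℤ) (X 1) * icosT (X 2) (X 3) =
      coeffC ^ 6 + 60 * coeffA ^ 2 * coeffB * coeffC ^ 4 + 576 * coeffA ^ 5 * coeffC ^ 3 - 180 * coeffA * coeffB ^ 3 * coeffC ^ 3 + 648 * coeffB ^ 5 * coeffC ^ 2 - 2760 * coeffA ^ 4 * coeffB ^ 2 * coeffC ^ 2 + 7200 * coeffA ^ 7 * coeffB * coeffC - 1728 * coeffA ^ 10 + 9360 * coeffA ^ 3 * coeffB ^ 4 * coeffC - 2080 * coeffA ^ 6 * coeffB ^ 3 - 16200 * coeffA ^ 2 * coeffB ^ 6 :=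
  T_aux _ _ _ _ _ _ _ rfl rfl rfl
end
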